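/- Let R be a commutative noetherian ring and C a semidualizing R-module. For all flat R-modules F and F' and all i ≥ 0 there is an isomorphism Ext_R^i(F' ⊗_R C, F ⊗_R C) ≅ Ext_R^i(F', F). -/

import Mathlib

open CategoryTheory TensorProduct

universe u

section
variable (R : Type u) [CommRing R]

def extZero (M N : ModuleCat.{u} R) : Prop :=
  ∀ i : ℕ, 1 ≤ i → Subsingleton (((Ext R (ModuleCat.{u} R) i).obj (Opposite.op M)).obj N)

def torZero (M N : ModuleCat.{u} R) : Prop :=
  ∀ i : ℕ, 1 ≤ i → Subsingleton (((Tor (ModuleCat.{u} R) i).obj M).obj N)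

def IsSemidualizing (C : ModuleCat.{u} R) : Prop :=
  Module.Finite R C ∧ Function.Bijective (LinearMap.lsmul R C) ∧ extZero R C C

/-- A module is `C`-flat if it is isomorphic to `F ⊗[R] C` with `F` flat. -/
def IsCFlat (C M : ModuleCat.{u} R) : Prop :=
  ∃ F : ModuleCat.{u} R, Module.Flat R F ∧ Nonempty (M ≃ₗ[R] (F ⊗[R] C))

def IsCInjective (C M : ModuleCat.{u} R) : Prop :=
  ∃ I : ModuleCat.{u} R, Module.Injective R I ∧ Nonempty (M ≃ₗ[R] (↥C →ₗ[R] ↥I))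

/-- cotorsion: `Ext^{≥1}(F, N) = 0` for all flat `F`. -/
def IsCotorsion (N : ModuleCat.{u} R) : Prop :=
  ∀ F : ModuleCat.{u} R, Module.Flat R F → extZero R F N

/-- `C`-cotorsion: `Ext^{≥1}(F ⊗ C, N) = 0` for all flat `F`. -/
def IsCCotorsion (C N : ModuleCat.{u} R) : Prop :=
  ∀ F : ModuleCat.{u} R, Module.Flat R F →
    extZero R (ModuleCat.of R (↥F ⊗[R] ↥C)) N

/-- `C`-flat `C`-cotorsion: isomorphic to `F ⊗ C` with `F` flat and cotorsion. -/
def IsCFlatCotorsion (C M : ModuleCat.{u} R) : Prop :=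
  ∃ F : ModuleCat.{u} R, Module.Flat R F ∧ IsCotorsion R F ∧
    Nonempty (M ≃ₗ[R] (F ⊗[R] C))

/-- The natural evaluation map `C ⊗ Hom(C,M) → M`. -/
noncomputable def evalMap (C M : ModuleCat.{u} R) :
    (↥C ⊗[R] (↥C →ₗ[R] ↥M)) →ₗ[R] ↥M :=
  TensorProduct.lift (LinearMap.id (R := R) (M := ↥C →ₗ[R] ↥M)).flip

/-- The Bass class `B_C(R)`. -/
noncomputable def InBassClass (C M : ModuleCat.{u} R) : Prop :=
  extZero R C M ∧
  torZero R C (ModuleCat.of R (↥C →ₗ[R] ↥M)) ∧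
  Function.Bijective (evalMap R C M)

/-- A `ℤ`-indexed complex of `R`-modules: `d i : X (i+1) → X i`. -/
structure ZComplex where
  X : ℤ → ModuleCat.{u} R
  d : ∀ i : ℤ, ↥(X (i + 1)) →ₗ[R] ↥(X i)
  d_comp_d : ∀ i : ℤ, (d i).comp (d (i + 1)) = 0

namespace ZComplex

variable {R} (Z : ZComplex R)

/-- Exactness of the complex. -/
def IsExact : Prop := ∀ i : ℤ, Function.Exact (Z.d (i + 1)) (Z.d i)

/-- Exactness of `Z ⊗[R] J`. -/
def TensorExact (J : ModuleCat.{u} R) : Prop :=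
  ∀ i : ℤ, Function.Exact (LinearMap.rTensor (↥J) (Z.d (i + 1)))
    (LinearMap.rTensor (↥J) (Z.d i))

/-- Exactness of `Hom_R(V, Z)`. -/
def HomFromExact (V : ModuleCat.{u} R) : Prop :=
  ∀ i : ℤ, Function.Exact
    (fun f : ↥V →ₗ[R] ↥(Z.X (i + 1 + 1)) => (Z.d (i + 1)).comp f)
    (fun f : ↥V →ₗ[R] ↥(Z.X (i + 1)) => (Z.d i).comp f)

/-- Exactness of `Hom_R(Z, V)`. -/
def HomToExact (V : ModuleCat.{u} R) : Prop :=
  ∀ i : ℤ, Function.Exact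
    (fun g : ↥(Z.X i) →ₗ[R] ↥V => g.comp (Z.d i))
    (fun g : ↥(Z.X (i + 1)) →ₗ[R] ↥V => g.comp (Z.d (i + 1)))

/-- `M ≅ Coker(∂₁)`. -/
def IsCokerOfD1 (M : ModuleCat.{u} R) : Prop :=
  Nonempty (↥M ≃ₗ[R] (↥(Z.X 0) ⧸ LinearMap.range (Z.d 0)))

end ZComplex

end

section
variable (R : Type u) [CommRing R]

/-- A complete `FF_C`-resolution witnessing that `M` is `G_C`-flat. -/
def IsGCFlat (C M : ModuleCat.{u} R) : Prop :=
  ∃ Z : ZComplex R, Z.IsExact ∧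
    (∀ i : ℤ, 0 ≤ i → Module.Flat R (Z.X i)) ∧
    (∀ i : ℤ, i < 0 → IsCFlat R C (Z.X i)) ∧
    (∀ J : ModuleCat.{u} R, IsCInjective R C J → Z.TensorExact J) ∧
    Z.IsCokerOfD1 M

def IsCProjective (C M : ModuleCat.{u} R) : Prop :=
  ∃ P : ModuleCat.{u} R, Module.Projective R P ∧ Nonempty (M ≃ₗ[R] (P ⊗[R] C))

/-- A complete `PP_C`-resolution witnessing that `M` is `G_C`-projective. -/
def IsGCProjective (C M : ModuleCat.{u} R) : Prop :=
  ∃ Z : ZComplex R, Z.IsExact ∧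
    (∀ i : ℤ, 0 ≤ i → Module.Projective R (Z.X i)) ∧
    (∀ i : ℤ, i < 0 → IsCProjective R C (Z.X i)) ∧
    (∀ Q : ModuleCat.{u} R, IsCProjective R C Q → Z.HomToExact Q) ∧
    Z.IsCokerOfD1 M

/-- `G(𝒳)` for a class `𝒳` of modules. -/
def GClass (𝒳 : ModuleCat.{u} R → Prop) (M : ModuleCat.{u} R) : Prop :=
  ∃ Z : ZComplex R, Z.IsExact ∧
    (∀ i : ℤ, 𝒳 (Z.X i)) ∧
    (∀ V : ModuleCat.{u} R, 𝒳 V → Z.HomFromExact V) ∧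
    (∀ V : ModuleCat.{u} R, 𝒳 V → Z.HomToExact V) ∧
    Z.IsCokerOfD1 M

/-- Iterates `G^n(𝒳)`, with `G^0(𝒳) = 𝒳`. -/
def GIter : ℕ → (ModuleCat.{u} R → Prop) → (ModuleCat.{u} R → Prop)
  | 0, 𝒳 => 𝒳
  | n + 1, 𝒳 => GClass R (GIter n 𝒳)

/-- `H_C(𝒳)`: modules with a `P_C F_C^cot`-complete `𝒳`-resolution. -/
def HClass (C : ModuleCat.{u} R) (𝒳 : ModuleCat.{u} R → Prop) (M : ModuleCat.{u} R) : Prop :=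
  ∃ Z : ZComplex R, Z.IsExact ∧
    (∀ i : ℤ, 𝒳 (Z.X i)) ∧
    (∀ P : ModuleCat.{u} R, Module.Projective R P →
      Z.HomFromExact (ModuleCat.of R (↥P ⊗[R] ↥C))) ∧
    (∀ N : ModuleCat.{u} R, IsCFlatCotorsion R C N → Z.HomToExact N) ∧
    Z.IsCokerOfD1 M

/-- Iterates `H_C^n(𝒳)`, with `H_C^0(𝒳) = 𝒳`. -/
def HIter (C : ModuleCat.{u} R) : ℕ → (ModuleCat.{u} R → Prop) → (ModuleCat.{u} R → Prop)
  | 0, 𝒳 => 𝒳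
  | n + 1, 𝒳 => HClass R C (HIter C n 𝒳)

/-- `M` admits a resolution `0 → X_n → ⋯ → X_0 → M → 0` with each `X_i` in `𝒳`. -/
def HasResOfLength (𝒳 : ModuleCat.{u} R → Prop) (n : ℕ) (M : ModuleCat.{u} R) : Prop :=
  ∃ (P : ℕ → ModuleCat.{u} R) (d : ∀ i : ℕ, ↥(P (i + 1)) →ₗ[R] ↥(P i))
    (ε : ↥(P 0) →ₗ[R] ↥M),
      Function.Surjective ε ∧ Function.Exact (d 0) ε ∧
      (∀ i : ℕ, Function.Exact (d (i + 1)) (d i)) ∧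
      (∀ i : ℕ, i ≤ n → 𝒳 (P i)) ∧
      (∀ i : ℕ, n < i → Subsingleton (P i))

/-- `M` admits a coresolution `0 → M → Y_0 → ⋯ → Y_n → 0` with each `Y_i` in `𝒳`. -/
def HasCoresOfLength (𝒳 : ModuleCat.{u} R → Prop) (n : ℕ) (M : ModuleCat.{u} R) : Prop :=
  ∃ (P : ℕ → ModuleCat.{u} R) (d : ∀ i : ℕ, ↥(P i) →ₗ[R] ↥(P (i + 1)))
    (η : ↥M →ₗ[R] ↥(P 0)),
      Function.Injective η ∧ Function.Exact η (d 0) ∧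
      (∀ i : ℕ, Function.Exact (d i) (d (i + 1))) ∧
      (∀ i : ℕ, i ≤ n → 𝒳 (P i)) ∧
      (∀ i : ℕ, n < i → Subsingleton (P i))

/-- `C` is a dualizing module: semidualizing of finite injective dimension. -/
def IsDualizing (C : ModuleCat.{u} R) : Prop :=
  IsSemidualizing R C ∧
  ∃ n : ℕ, HasCoresOfLength R (fun I => Module.Injective R ↥I) n C

end

section
variable {R : Type u} [CommRing R]

/-- `Ext` of unbundled modules, taken in the derived category. -/
abbrev ModuleExt (R : Type u) [CommRing R] (M N : Type u) [AddCommGroup M] [Module R M]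
    [AddCommGroup N] [Module R N] (n : ℕ) : Type u :=
  Abelian.Ext.{u} (ModuleCat.of R M) (ModuleCat.of R N) n

theorem exists_projective_surjective (M : Type u) [AddCommGroup M] [Module R M] :
    ∃ (P : Type u) (_ : AddCommGroup P) (_ : Module R P) (p : P →ₗ[R] M),
      Module.Projective R P ∧ Function.Surjective p :=
  ⟨M →₀ R, inferInstance, inferInstance, _, inferInstance,
    Finsupp.linearCombination_id_surjective R M⟩

section HomTensor

variable {F M N : Type u} [AddCommGroup F] [Module R F] [AddCommGroup M] [Module R M]
  [AddCommGroup N] [Module R N]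

theorem lcomp_lTensorHomToHomLTensor {P : Type u} [AddCommGroup P] [Module R P] (p : P →ₗ[R] M)
    (x : F ⊗[R] (M →ₗ[R] N)) :
    lTensorHomToHomLTensor (.id R) P F N ((LinearMap.lcomp R N p).lTensor F x) =
      lTensorHomToHomLTensor (.id R) M F N x ∘ₗ p := by
  induction x with
  | zero => simp
  | add x y hx hy => simp only [map_add, hx, hy, LinearMap.add_comp]
  | tmul a f => ext; simp

theorem lTensorHomToHomLTensor_injective [Module.Flat R F] [Module.Finite R M] :
    Function.Injective (lTensorHomToHomLTensor (.id R) M F N) := by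
  obtain ⟨n, p, hp⟩ := Module.Finite.exists_fin' R M
  have h₁ : Function.Injective ((LinearMap.lcomp R N p).lTensor F) :=
    Module.Flat.lTensor_preserves_injective_linearMap _
      (LinearMap.lcomp_injective_of_surjective p hp)
  have h₂ : Function.Injective (lTensorHomToHomLTensor (.id R) (Fin n → R) F N) := by
    rw [← lTensorHomEquivHomLTensor_toLinearMap]
    exact LinearEquiv.injective _
  intro x y hxy
  apply h₁
  apply h₂
  simp only [lcomp_lTensorHomToHomLTensor, hxy]

theorem lTensorHomToHomLTensor_bijective [IsNoetherianRing R] [Module.Flat R F]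
    [Module.Finite R M] : Function.Bijective (lTensorHomToHomLTensor (.id R) M F N) := by
  refine ⟨lTensorHomToHomLTensor_injective, fun g ↦ ?_⟩
  obtain ⟨n, p, hp⟩ := Module.Finite.exists_fin' R M
  obtain ⟨x, hx⟩ : ∃ x, lTensorHomToHomLTensor (.id R) (Fin n → R) F N x = g ∘ₗ p := by
    rw [← lTensorHomEquivHomLTensor_toLinearMap]
    exact LinearEquiv.surjective _ _
  have hx₀ : (LinearMap.lcomp R N (LinearMap.ker p).subtype).lTensor F x = 0 := by
    apply lTensorHomToHomLTensor_injective
    rw [lcomp_lTensorHomToHomLTensor, hx, map_zero, LinearMap.comp_assoc,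
      LinearMap.comp_ker_subtype, LinearMap.comp_zero]
  have hexact : Function.Exact (LinearMap.lcomp R N p)
      (LinearMap.lcomp R N (LinearMap.ker p).subtype) :=
    LinearMap.exact_lcomp_of_exact_of_surjective N p.exact_subtype_ker_map hp
  obtain ⟨y, rfl⟩ := (Module.Flat.lTensor_exact F hexact x).mp hx₀
  refine ⟨y, ?_⟩
  rw [lcomp_lTensorHomToHomLTensor] at hx
  exact LinearMap.cancel_right hp |>.mp hx

end HomTensor

section Shift

variable {K P M : Type u} [AddCommGroup K] [Module R K] [AddCommGroup P] [Module R P]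
  [AddCommGroup M] [Module R M] (N : Type u) [AddCommGroup N] [Module R N]
  {f : K →ₗ[R] P} {g : P →ₗ[R] M}

theorem shortExact_of_exact (hf : Function.Injective f) (hfg : Function.Exact f g)
    (hg : Function.Surjective g) :
    (ModuleCat.shortComplexOfCompEqZero f g hfg.linearMap_comp_eq_zero).ShortExact :=
  ModuleCat.shortComplex_shortExact _ hfg hf hg

theorem nonempty_moduleExt_one_equiv (hf : Function.Injective f) (hfg : Function.Exact f g)
    (hg : Function.Surjective g) (hP : Subsingleton (ModuleExt R P N 1)) :
    Nonempty (((K →ₗ[R] N) ⧸ LinearMap.range (LinearMap.lcomp R N f)) ≃ₗ[R]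
      ModuleExt R M N 1) := by
  have hS := shortExact_of_exact hf hfg hg
  let e (A : Type u) [AddCommGroup A] [Module R A] : (A →ₗ[R] N) ≃ₗ[R] ModuleExt R A N 0 :=
    (Abelian.Ext.linearEquiv₀.trans ModuleCat.homLinearEquiv).symm
  have he (b : P →ₗ[R] N) :
      e K (b ∘ₗ f) = (Abelian.Ext.mk₀ (ModuleCat.ofHom f)).comp (e P b) (zero_add 0) :=
    (Abelian.Ext.mk₀_comp_mk₀ (ModuleCat.ofHom f) (ModuleCat.ofHom b)).symm
  let δ' : ModuleExt R K N 0 →ₗ[R] ModuleExt R M N 1 :=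
    hS.extClass.precompOfLinear R (ModuleCat.of R N) (add_zero 1)
  have hδ' : Function.Surjective δ' := fun x ↦
    Abelian.Ext.contravariant_sequence_exact₃ hS _ x (Subsingleton.elim (h := hP) _ _) (add_zero 1)
  let δ : (K →ₗ[R] N) →ₗ[R] ModuleExt R M N 1 := δ' ∘ₗ (e K).toLinearMap
  have hδ : Function.Surjective δ := hδ'.comp (e K).surjective
  have hker : LinearMap.range (LinearMap.lcomp R N f) = LinearMap.ker δ := by
    ext a
    constructor
    · rintro ⟨b, rfl⟩
      change δ' (e K (b ∘ₗ f)) = 0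
      rw [he]
      exact hS.extClass_comp_assoc (e P b) (h := add_zero 1)
    · intro ha
      obtain ⟨b, hb⟩ := Abelian.Ext.contravariant_sequence_exact₁ hS _ (e K a) (add_zero 1) ha
      obtain ⟨b, rfl⟩ := (e P).surjective b
      exact ⟨b, (e K).injective ((he b).trans hb)⟩
  exact ⟨(Submodule.quotEquivOfEq _ _ hker).trans (δ.quotKerEquivOfSurjective hδ)⟩

theorem nonempty_moduleExt_succ_equiv (hf : Function.Injective f) (hfg : Function.Exact f g)
    (hg : Function.Surjective g) (hP : ∀ n, Subsingleton (ModuleExt R P N (n + 1))) (n : ℕ) :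
    Nonempty (ModuleExt R K N (n + 1) ≃ₗ[R] ModuleExt R M N (n + 2)) := by
  have hS := shortExact_of_exact hf hfg hg
  let δ : ModuleExt R K N (n + 1) →ₗ[R] ModuleExt R M N (n + 2) :=
    hS.extClass.precompOfLinear R (ModuleCat.of R N) (add_comm 1 (n + 1))
  refine ⟨LinearEquiv.ofBijective δ ⟨?_, fun x ↦ ?_⟩⟩
  · rw [← LinearMap.ker_eq_bot, LinearMap.ker_eq_bot']
    intro x hx
    obtain ⟨y, rfl⟩ := Abelian.Ext.contravariant_sequence_exact₁ hS _ x (add_comm 1 (n + 1)) hx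
    rw [Subsingleton.elim (h := hP n) y 0, Abelian.Ext.comp_zero]
  · exact Abelian.Ext.contravariant_sequence_exact₃ hS _ x (Subsingleton.elim (h := hP _) _ _)
      (add_comm 1 (n + 1))

theorem subsingleton_moduleExt_one_iff (hf : Function.Injective f) (hfg : Function.Exact f g)
    (hg : Function.Surjective g) (hP : Subsingleton (ModuleExt R P N 1)) :
    Subsingleton (ModuleExt R M N 1) ↔ Function.Surjective (LinearMap.lcomp R N f) := by
  obtain ⟨e⟩ := nonempty_moduleExt_one_equiv N hf hfg hg hP
  rw [← e.toEquiv.subsingleton_congr, Submodule.Quotient.subsingleton_iff,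
    LinearMap.range_eq_top]

end Shift

section Vanishing

theorem subsingleton_moduleExt_of_projective (P N : Type u) [AddCommGroup P] [Module R P]
    [AddCommGroup N] [Module R N] [Module.Projective R P] (n : ℕ) :
    Subsingleton (ModuleExt R P N (n + 1)) :=
  Abelian.Ext.subsingleton_of_projective _ _ _

variable {C : Type u} [AddCommGroup C] [Module R C]

/-- If `F` is flat and `Ext^{≥1}(M, C) = 0` then `Ext^{≥1}(M, F ⊗ C) = 0`, for `M` finite over a
noetherian ring. -/
theorem subsingleton_moduleExt_flat_tensor [IsNoetherianRing R] (F : Type u) [AddCommGroup F]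
    [Module R F] [Module.Flat R F] (n : ℕ) (M : Type u) [AddCommGroup M] [Module R M]
    [Module.Finite R M] (hM : ∀ n, Subsingleton (ModuleExt R M C (n + 1))) :
    Subsingleton (ModuleExt R M (F ⊗[R] C) (n + 1)) := by
  induction n using Nat.strong_induction_on generalizing M with | h n ih
  obtain ⟨m, p, hp⟩ := Module.Finite.exists_fin' R M
  have hi := (LinearMap.ker p).injective_subtype
  have hip := p.exact_subtype_ker_map
  have hproj (N : Type u) [AddCommGroup N] [Module R N] :=
    subsingleton_moduleExt_of_projective (R := R) (Fin m → R) N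
  obtain _ | n := n
  · rw [zero_add, subsingleton_moduleExt_one_iff _ hi hip hp (hproj _ 0)]
    intro a
    obtain ⟨x, rfl⟩ := lTensorHomToHomLTensor_bijective.surjective a
    obtain ⟨y, rfl⟩ := LinearMap.lTensor_surjective F
      ((subsingleton_moduleExt_one_iff C hi hip hp (hproj _ 0)).mp (hM 0)) x
    exact ⟨_, (lcomp_lTensorHomToHomLTensor _ y).symm⟩
  · obtain ⟨e⟩ := nonempty_moduleExt_succ_equiv (F ⊗[R] C) hi hip hp (hproj _) n
    rw [← e.toEquiv.subsingleton_congr]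
    refine ih n n.lt_succ_self _ fun k ↦ ?_
    obtain ⟨e'⟩ := nonempty_moduleExt_succ_equiv C hi hip hp (hproj _) k
    exact e'.toEquiv.subsingleton_congr.mpr (hM _)

/-- If `P` is projective and `Ext^{≥1}(M, N) = 0` then `Ext^{≥1}(P ⊗ M, N) = 0`. -/
theorem subsingleton_moduleExt_projective_tensor (P N : Type u) [AddCommGroup P] [Module R P]
    [Module.Projective R P] [AddCommGroup N] [Module R N] (n : ℕ) (M : Type u) [AddCommGroup M]
    [Module R M] (hM : ∀ n, Subsingleton (ModuleExt R M N (n + 1))) :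
    Subsingleton (ModuleExt R (P ⊗[R] M) N (n + 1)) := by
  induction n using Nat.strong_induction_on generalizing M with | h n ih
  obtain ⟨Q, _, _, p, _, hp⟩ := exists_projective_surjective (R := R) M
  have hi := (LinearMap.ker p).injective_subtype
  have hip := p.exact_subtype_ker_map
  have hPi := Module.Flat.lTensor_preserves_injective_linearMap (M := P) _ hi
  have hPip := Module.Flat.lTensor_exact P hip
  have hPp := LinearMap.lTensor_surjective P hp
  have hproj := subsingleton_moduleExt_of_projective (R := R) Q N
  have hPproj := subsingleton_moduleExt_of_projective (R := R) (P ⊗[R] Q) N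
  obtain _ | n := n
  · rw [zero_add, subsingleton_moduleExt_one_iff _ hPi hPip hPp (hPproj 0)]
    intro a
    obtain ⟨b, hb⟩ := Module.projective_lifting_property _ (TensorProduct.curry a)
      ((subsingleton_moduleExt_one_iff N hi hip hp (hproj 0)).mp (hM 0))
    refine ⟨TensorProduct.lift b, TensorProduct.ext' fun x y ↦ ?_⟩
    simpa using LinearMap.congr_fun (LinearMap.congr_fun hb x) y
  · obtain ⟨e⟩ := nonempty_moduleExt_succ_equiv N hPi hPip hPp hPproj n
    rw [← e.toEquiv.subsingleton_congr]
    refine ih n n.lt_succ_self _ fun k ↦ ?_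
    obtain ⟨e'⟩ := nonempty_moduleExt_succ_equiv N hi hip hp hproj k
    exact e'.toEquiv.subsingleton_congr.mpr (hM _)

end Vanishing

section Flat

variable {K P M : Type u} [AddCommGroup K] [Module R K] [AddCommGroup P] [Module R P]
  [AddCommGroup M] [Module R M] {f : K →ₗ[R] P} {g : P →ₗ[R] M}

/-- An exact sequence ending in a flat module is pure. -/
theorem rTensor_injective_of_exact_of_flat [Module.Flat R M] (hf : Function.Injective f)
    (hfg : Function.Exact f g) (hg : Function.Surjective g) (C : Type u) [AddCommGroup C]
    [Module R C] : Function.Injective (f.rTensor C) := by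
  obtain ⟨Q, _, _, q, _, hq⟩ := exists_projective_surjective (R := R) C
  let ι := (LinearMap.ker q).subtype
  have hι : Function.Injective ι := (LinearMap.ker q).injective_subtype
  have hιq : Function.Exact ι q := q.exact_subtype_ker_map
  have comm {A A' B B' : Type u} [AddCommGroup A] [Module R A] [AddCommGroup A'] [Module R A']
      [AddCommGroup B] [Module R B] [AddCommGroup B'] [Module R B'] (s : A →ₗ[R] A')
      (t : B →ₗ[R] B') (x : A ⊗[R] B) :
      s.rTensor B' (t.lTensor A x) = t.lTensor A' (s.rTensor B x) :=
    LinearMap.congr_fun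
      ((LinearMap.rTensor_comp_lTensor ..).trans (LinearMap.lTensor_comp_rTensor ..).symm) x
  rw [injective_iff_map_eq_zero]
  intro x hx
  obtain ⟨x, rfl⟩ := LinearMap.lTensor_surjective K hq x
  rw [comm] at hx
  obtain ⟨y, hy⟩ := (lTensor_exact P hιq hq _).mp hx
  have hy₀ : g.rTensor _ y = 0 := by
    apply Module.Flat.lTensor_preserves_injective_linearMap (M := M) ι hι
    rw [← comm, hy, map_zero]
    exact (rTensor_exact Q hfg hg).apply_apply_eq_zero x
  obtain ⟨z, rfl⟩ := (rTensor_exact _ hfg hg _).mp hy₀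
  have hz : ι.lTensor K z = x :=
    Module.Flat.rTensor_preserves_injective_linearMap (M := Q) f hf ((comm _ _ _).trans hy)
  rw [← hz]
  exact (lTensor_exact K hιq hq).apply_apply_eq_zero z

theorem flat_of_exact [Module.Flat R P] [Module.Flat R M] (hf : Function.Injective f)
    (hfg : Function.Exact f g) (hg : Function.Surjective g) : Module.Flat R K := by
  rw [Module.Flat.iff_lTensor_preserves_injective_linearMap]
  intro N N' _ _ _ _ j hj
  have h := (Module.Flat.lTensor_preserves_injective_linearMap (M := P) j hj).comp
    (rTensor_injective_of_exact_of_flat hf hfg hg N)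
  rw [← LinearMap.coe_comp, LinearMap.lTensor_comp_rTensor, ← LinearMap.rTensor_comp_lTensor,
    LinearMap.coe_comp] at h
  exact h.of_comp

end Flat

section Adjunction

/-- Derived tensor-hom adjunction. -/
theorem nonempty_moduleExt_tensor_equiv {C N : Type u} [AddCommGroup C] [Module R C]
    [AddCommGroup N] [Module R N] (hC : ∀ n, Subsingleton (ModuleExt R C N (n + 1))) (n : ℕ)
    (M : Type u) [AddCommGroup M] [Module R M] [Module.Flat R M] :
    Nonempty (ModuleExt R (M ⊗[R] C) N n ≃ₗ[R] ModuleExt R M (C →ₗ[R] N) n) := by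
  let adj (A : Type u) [AddCommGroup A] [Module R A] :
      (A ⊗[R] C →ₗ[R] N) ≃ₗ[R] (A →ₗ[R] C →ₗ[R] N) :=
    (TensorProduct.lift.equiv (.id R) A C N).symm
  induction n using Nat.strong_induction_on generalizing M with | h n ih
  obtain ⟨P, _, _, p, _, hp⟩ := exists_projective_surjective (R := R) M
  have hi := (LinearMap.ker p).injective_subtype
  have hip := p.exact_subtype_ker_map
  have hiC := rTensor_injective_of_exact_of_flat hi hip hp C
  have hipC := rTensor_exact C hip hp
  have hpC := LinearMap.rTensor_surjective C hp
  have hproj := subsingleton_moduleExt_of_projective (R := R) P (C →ₗ[R] N)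
  have hprojC (n : ℕ) := subsingleton_moduleExt_projective_tensor P N n C hC
  obtain _ | _ | n := n
  · exact ⟨(Abelian.Ext.linearEquiv₀.trans ModuleCat.homLinearEquiv).trans ((adj M).trans
      (Abelian.Ext.linearEquiv₀.trans ModuleCat.homLinearEquiv).symm)⟩
  · obtain ⟨e⟩ := nonempty_moduleExt_one_equiv N hiC hipC hpC (hprojC 0)
    obtain ⟨e'⟩ := nonempty_moduleExt_one_equiv (C →ₗ[R] N) hi hip hp (hproj 0)
    refine ⟨e.symm.trans ((Submodule.Quotient.equiv _ _ (adj _) ?_).trans e')⟩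
    have hadj (b : P ⊗[R] C →ₗ[R] N) : adj _ (b ∘ₗ (LinearMap.ker p).subtype.rTensor C) =
        adj _ b ∘ₗ (LinearMap.ker p).subtype := rfl
    ext a
    constructor
    · rintro ⟨_, ⟨b, rfl⟩, rfl⟩
      exact ⟨adj _ b, (hadj b).symm⟩
    · rintro ⟨b, rfl⟩
      obtain ⟨b, rfl⟩ := (adj _).surjective b
      exact ⟨_, ⟨b, rfl⟩, hadj b⟩
  · have := flat_of_exact hi hip hp
    obtain ⟨e⟩ := nonempty_moduleExt_succ_equiv N hiC hipC hpC hprojC n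
    obtain ⟨e'⟩ := nonempty_moduleExt_succ_equiv (C →ₗ[R] N) hi hip hp hproj n
    obtain ⟨e''⟩ := ih (n + 1) (by lia) (LinearMap.ker p)
    exact ⟨e.symm.trans (e''.trans e')⟩

end Adjunction

section Comparison

variable {C : Type*} [Category* C] [Abelian C] [Linear R C] [HasExt.{u} C]

/-- The map from cocycles to `Ext` given by a projective resolution. -/
noncomputable def extOfCocycle {X : C} (P : ProjectiveResolution X) (Y : C) (n : ℕ) :
    LinearMap.ker (Linear.leftComp R Y (P.complex.d (n + 1) n)) →ₗ[R] Abelian.Ext.{u} X Y n where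
  toFun f := P.extMk f.1 (n + 1) rfl (show _ ≫ f.1 = 0 from f.2)
  map_add' f g := (P.add_extMk _ _ _ _ _ _).symm
  map_smul' r f := by
    rw [RingHom.id_apply, Abelian.Ext.smul_eq_comp_mk₀, P.extMk_comp_mk₀]
    simp

theorem extOfCocycle_surjective {X : C} (P : ProjectiveResolution X) (Y : C) (n : ℕ) :
    Function.Surjective (extOfCocycle (R := R) P Y n) := fun x ↦
  let ⟨f, hf, h⟩ := P.extMk_surjective x (n + 1) rfl
  ⟨⟨f, hf⟩, h⟩

theorem extMk_zero_eq_zero_iff {X Y : C} (P : ProjectiveResolution X) (f : P.complex.X 0 ⟶ Y)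
    (hf : P.complex.d 1 0 ≫ f = 0) : P.extMk f 1 rfl hf = 0 ↔ f = 0 := by
  refine ⟨fun h ↦ ?_, fun h ↦ by subst h; simp⟩
  rw [← P.extEquivCohomologyClass.apply_eq_iff_eq, P.extEquivCohomologyClass_extMk,
    P.extEquivCohomologyClass_zero, CochainComplex.HomComplex.CohomologyClass.mk_eq_zero_iff,
    CochainComplex.HomComplex.Cocycle.toSingleMk_mem_coboundaries_iff _ _ _ _ _ 1 rfl] at h
  obtain ⟨g, hg⟩ := h
  rw [(CochainComplex.isZero_of_isStrictlyLE _ 0 1).eq_zero_of_src g, Limits.comp_zero] at hg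
  exact (cancel_epi (P.cochainComplexXIso 0 0 rfl).hom).mp (hg.symm.trans Limits.comp_zero.symm)

theorem extOfCocycle_eq_zero_iff {X : C} (P : ProjectiveResolution X) (Y : C) (n : ℕ)
    (f : LinearMap.ker (Linear.leftComp R Y (P.complex.d (n + 1) n))) :
    extOfCocycle P Y n f = 0 ↔
      ∃ g, P.complex.d n ((ComplexShape.down ℕ).next n) ≫ g = f.1 := by
  obtain _ | n := n
  · have hd : P.complex.d 0 ((ComplexShape.down ℕ).next 0) = 0 := P.complex.shape _ _ (by simp)
    rw [hd]
    exact (extMk_zero_eq_zero_iff P f.1 f.2).trans (by simp [eq_comm])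
  · exact P.extMk_eq_zero_iff f.1 (n + 2) rfl f.2 _ (by simp)

/-- `Ext` computed by projective resolutions agrees with `Ext` in the derived category. -/
theorem nonempty_ext_equiv_abelianExt [EnoughProjectives C] (X Y : C) (n : ℕ) :
    Nonempty (((Ext R C n).obj (Opposite.op X)).obj Y ≃ₗ[R] Abelian.Ext.{u} X Y n) := by
  let P := ProjectiveResolution.of X
  let K := P.complex.linearYonedaObj R Y
  let S := K.sc' ((ComplexShape.down ℕ).next n) n (n + 1)
  let e : ((Ext R C n).obj (Opposite.op X)).obj Y ≅ S.moduleCatLeftHomologyData.H :=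
    P.isoExt n Y ≪≫ K.homologyIsoSc' _ n (n + 1) rfl (by simp) ≪≫ S.moduleCatHomologyIso
  let δ : LinearMap.ker S.g.hom →ₗ[R] Abelian.Ext.{u} X Y n := extOfCocycle P Y n
  have hδ : Function.Surjective δ := extOfCocycle_surjective P Y n
  have hker : LinearMap.range S.moduleCatToCycles = LinearMap.ker δ := by
    ext f
    exact Iff.trans ⟨fun ⟨g, hg⟩ ↦ ⟨g, congrArg Subtype.val hg⟩,
      fun ⟨g, hg⟩ ↦ ⟨g, Subtype.ext hg⟩⟩ (extOfCocycle_eq_zero_iff P Y n f).symm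
  exact ⟨e.toLinearEquiv.trans
    ((Submodule.quotEquivOfEq _ _ hker).trans (δ.quotKerEquivOfSurjective hδ))⟩

end Comparison
theorem extZero_iff (M N : ModuleCat.{u} R) :
    extZero R M N ↔ ∀ n, Subsingleton (ModuleExt R M N (n + 1)) := by
  have h (n : ℕ) := (nonempty_ext_equiv_abelianExt (R := R) M N n).some.toEquiv.subsingleton_congr
  refine ⟨fun H n ↦ (h _).mp (H _ (by lia)), fun H n hn ↦ ?_⟩
  obtain ⟨n, rfl⟩ := Nat.exists_eq_add_of_le' hn
  exact (h _).mpr (H n)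

/-- If homotheties induce `R ≃ Hom(C, C)`, then `F ≃ Hom(C, F ⊗ C)` for `F` flat. -/
theorem nonempty_linearMap_tensor_equiv [IsNoetherianRing R] {C F : Type u} [AddCommGroup C]
    [Module R C] [Module.Finite R C] [AddCommGroup F] [Module R F] [Module.Flat R F]
    (hC : Function.Bijective (LinearMap.lsmul R C)) : Nonempty ((C →ₗ[R] F ⊗[R] C) ≃ₗ[R] F) :=
  ⟨(LinearEquiv.ofBijective _ lTensorHomToHomLTensor_bijective).symm.trans
    (((LinearEquiv.ofBijective _ hC).symm.lTensor F).trans (TensorProduct.rid R F))⟩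

end

/-- For flat modules `F`, `F'` and all `i ≥ 0`,
`Ext_R^i(F' ⊗ C, F ⊗ C) ≅ Ext_R^i(F', F)`. -/
theorem stmt14 (R : Type u) [CommRing R] [IsNoetherianRing R]
    (C : ModuleCat.{u} R) (hC : IsSemidualizing R C)
    (F F' : ModuleCat.{u} R) (hF : Module.Flat R F) (hF' : Module.Flat R F') (i : ℕ) :
    Nonempty
      (↥(((Ext R (ModuleCat.{u} R) i).obj
            (Opposite.op (ModuleCat.of R (↥F' ⊗[R] ↥C)))).obj
          (ModuleCat.of R (↥F ⊗[R] ↥C))) ≃ₗ[R]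
       ↥(((Ext R (ModuleCat.{u} R) i).obj (Opposite.op F')).obj F)) := by
  obtain ⟨hfin, hlsmul, hext⟩ := hC
  obtain ⟨e₁⟩ := nonempty_ext_equiv_abelianExt (R := R) (ModuleCat.of R (F' ⊗[R] C))
    (ModuleCat.of R (F ⊗[R] C)) i
  obtain ⟨e₂⟩ := nonempty_moduleExt_tensor_equiv (fun n ↦
    subsingleton_moduleExt_flat_tensor F n C ((extZero_iff C C).mp hext)) i F'
  obtain ⟨e₃⟩ := nonempty_ext_equiv_abelianExt (R := R) F' (ModuleCat.of R (C →ₗ[R] F ⊗[R] C)) i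
  obtain ⟨e₄⟩ := nonempty_linearMap_tensor_equiv (F := F) hlsmul
  exact ⟨(e₁.trans e₂).trans (e₃.symm.trans
    (((Ext R (ModuleCat.{u} R) i).obj (Opposite.op F')).mapIso e₄.toModuleIso).toLinearEquiv)⟩
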